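/- arXiv:math/0703443 — 4 statements merged into one kernel-verified Lean document; each statement's English description precedes it below -/
import Mathlib

section
/- The presented group ⟨a, b, c | a², b², c², (ac)⁴, [a,b], [b,c]⟩ is isomorphic to the direct product C₂ × D₄ of a cyclic group of order 2 and the dihedral group of order 8; in particular it has order 16. -/
/-- The commutator `[x, y] = x⁻¹y⁻¹xy`. -/
def commElt {M : Type*} [Group M] (x y : M) : M := x⁻¹ * y⁻¹ * x * y

/-- The relators `a², b², c², (ac)⁴, [a,b], [b,c]` in the free group on three
generators `a = 0`, `b = 1`, `c = 2`. -/
def quotRels : Set (FreeGroup (Fin 3)) :=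
  {(FreeGroup.of 0) ^ 2, (FreeGroup.of 1) ^ 2, (FreeGroup.of 2) ^ 2,
    (FreeGroup.of 0 * FreeGroup.of 2) ^ 4,
    commElt (FreeGroup.of 0) (FreeGroup.of 1), commElt (FreeGroup.of 1) (FreeGroup.of 2)}

/-- The homomorphism from the cyclic group `ZMod n` sending the generator to `x`,
where `x ^ n = 1`. -/
def zmodPowHom {G : Type*} [Group G] (n : ℕ) (x : G) (hx : x ^ n = 1) :
    Multiplicative (ZMod n) →* G :=
  AddMonoidHom.toMultiplicativeLeft
    (ZMod.lift n ⟨zmultiplesHom (Additive G) (Additive.ofMul x), by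
      simp [← ofMul_pow, hx]⟩)

theorem zmodPowHom_intCast {G : Type*} [Group G] {n : ℕ} {x : G} (hx : x ^ n = 1) (k : ℤ) :
    zmodPowHom n x hx (Multiplicative.ofAdd (k : ZMod n)) = x ^ k := by
  simp [zmodPowHom, ← ofMul_zpow]

theorem zmodPowHom_one {G : Type*} [Group G] {n : ℕ} {x : G} (hx : x ^ n = 1) :
    zmodPowHom n x hx (Multiplicative.ofAdd (1 : ZMod n)) = x := by
  simpa using zmodPowHom_intCast hx 1

theorem zmodPowHom_mul_comm {G : Type*} [Group G] {n : ℕ} {x y z : G} (hx : x ^ n = 1)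
    (hy : y ^ n = 1) (h : x * z = z * y) (i : Multiplicative (ZMod n)) :
    zmodPowHom n x hx i * z = z * zmodPowHom n y hy i := by
  obtain ⟨k, hk⟩ := ZMod.intCast_surjective i.toAdd
  obtain rfl : i = Multiplicative.ofAdd (k : ZMod n) := by rw [hk]; rfl
  rw [zmodPowHom_intCast, zmodPowHom_intCast]
  exact ((show SemiconjBy z y x from h.symm).zpow_right k).eq.symm

theorem zmodPowHom_inv {G : Type*} [Group G] {n : ℕ} {x : G} (hx : x ^ n = 1)
    (i : Multiplicative (ZMod n)) :
    zmodPowHom n x⁻¹ (by simp [hx]) i = (zmodPowHom n x hx i)⁻¹ := by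
  obtain ⟨k, hk⟩ := ZMod.intCast_surjective i.toAdd
  obtain rfl : i = Multiplicative.ofAdd (k : ZMod n) := by rw [hk]; rfl
  rw [zmodPowHom_intCast, zmodPowHom_intCast, inv_zpow]

/-- The homomorphism from the dihedral group determined by an involution `s` inverting
an element `x` with `x ^ n = 1`. -/
def dihedralLift {G : Type*} [Group G] (n : ℕ) (s x : G) (hs : s * s = 1) (hx : x ^ n = 1)
    (h : x * s = s * x⁻¹) : DihedralGroup n →* G :=
  have hcomm (i : Multiplicative (ZMod n)) :
      zmodPowHom n x hx i * s = s * (zmodPowHom n x hx i)⁻¹ := by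
    rw [← zmodPowHom_inv]; exact zmodPowHom_mul_comm _ _ h i
  MonoidHom.mk'
    (fun
      | .r i => zmodPowHom n x hx (Multiplicative.ofAdd i)
      | .sr i => s * zmodPowHom n x hx (Multiplicative.ofAdd i))
    (by
      have hsub (i j : ZMod n) : zmodPowHom n x hx (Multiplicative.ofAdd (j - i)) =
          (zmodPowHom n x hx (Multiplicative.ofAdd i))⁻¹ *
            zmodPowHom n x hx (Multiplicative.ofAdd j) := by
        rw [← map_inv, ← map_mul, ← ofAdd_neg, ← ofAdd_add, neg_add_eq_sub]
      rintro (i | i) (j | j)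
      · simp [ofAdd_add]
      · simp only [DihedralGroup.r_mul_sr, hsub]
        rw [← mul_assoc, ← mul_assoc, hcomm]
      · simp [ofAdd_add, mul_assoc]
      · simp only [DihedralGroup.sr_mul_sr, hsub]
        rw [← mul_assoc, mul_assoc s, hcomm, ← mul_assoc, hs, one_mul])


theorem dihedralLift_sr_zero {G : Type*} [Group G] {n : ℕ} {s x : G} (hs : s * s = 1)
    (hx : x ^ n = 1) (h : x * s = s * x⁻¹) :
    dihedralLift n s x hs hx h (.sr 0) = s := by
  change s * zmodPowHom n x hx 1 = s
  rw [map_one, mul_one]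

theorem dihedralLift_sr_one {G : Type*} [Group G] {n : ℕ} {s x : G} (hs : s * s = 1)
    (hx : x ^ n = 1) (h : x * s = s * x⁻¹) :
    dihedralLift n s x hs hx h (.sr 1) = s * x :=
  congrArg (s * ·) (zmodPowHom_one hx)

theorem commElt_eq_one_iff {M : Type*} [Group M] {x y : M} :
    commElt x y = 1 ↔ Commute x y := by
  rw [commElt, mul_assoc, ← mul_inv_rev, inv_mul_eq_one]
  exact eq_comm

/-- The images of `a, b, c` in `C₂ × D₄`: two reflections of `D₄` and the generator of `C₂`. -/
def quotGens : Fin 3 → Multiplicative (ZMod 2) × DihedralGroup 4 :=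
  ![(1, .sr 0), (Multiplicative.ofAdd 1, 1), (1, .sr 1)]

theorem lift_quotGens_eq_one : ∀ r ∈ quotRels, FreeGroup.lift quotGens r = 1 := by
  rintro r (rfl | rfl | rfl | rfl | rfl | rfl) <;>
    simp only [commElt, map_mul, map_pow, map_inv, FreeGroup.lift_apply_of] <;> decide

/-- The homomorphism from the presented group to `C₂ × D₄`. -/
def quotToProd : PresentedGroup quotRels →* Multiplicative (ZMod 2) × DihedralGroup 4 :=
  PresentedGroup.toGroup lift_quotGens_eq_one

theorem quotToProd_of (i : Fin 3) : quotToProd (PresentedGroup.of i) = quotGens i :=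
  PresentedGroup.toGroup.of lift_quotGens_eq_one

theorem quotToProd_surjective : Function.Surjective quotToProd := by
  have key : ∀ y : Multiplicative (ZMod 2) × DihedralGroup 4, ∃ i : Fin 2, ∃ j : Fin 2,
      ∃ k : Fin 4, quotGens 1 ^ (i : ℕ) * quotGens 0 ^ (j : ℕ) *
        (quotGens 0 * quotGens 2) ^ (k : ℕ) = y := by
    rintro ⟨i, k | k⟩ <;> revert i k <;> decide
  intro y
  obtain ⟨i, j, k, rfl⟩ := key y
  refine ⟨.of 1 ^ (i : ℕ) * .of 0 ^ (j : ℕ) * (.of 0 * .of 2) ^ (k : ℕ), ?_⟩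
  simp only [map_mul, map_pow, quotToProd_of]

theorem quotToProd_injective : Function.Injective quotToProd := by
  have rel {r : FreeGroup (Fin 3)} (hr : r ∈ quotRels) : PresentedGroup.mk quotRels r = 1 :=
    PresentedGroup.one_of_mem hr
  let a : PresentedGroup quotRels := .of 0
  let b : PresentedGroup quotRels := .of 1
  let c : PresentedGroup quotRels := .of 2
  have ha : a * a = 1 := by rw [← sq]; exact rel (by simp [quotRels])
  have hb : b ^ 2 = 1 := rel (by simp [quotRels])
  have hc : c * c = 1 := by rw [← sq]; exact rel (by simp [quotRels])
  have hac : (a * c) ^ 4 = 1 := rel (by simp [quotRels])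
  have hab : Commute a b := commElt_eq_one_iff.mp <|
    rel (r := commElt (.of 0) (.of 1)) (by simp [quotRels])
  have hbc : Commute b c := commElt_eq_one_iff.mp <|
    rel (r := commElt (.of 1) (.of 2)) (by simp [quotRels])
  have hinv : a * c * a = a * (a * c)⁻¹ := by
    rw [mul_inv_rev, inv_eq_of_mul_eq_one_left ha, inv_eq_of_mul_eq_one_left hc, mul_assoc]
  let f := zmodPowHom 2 b hb
  let g := dihedralLift 4 a (a * c) ha hac hinv
  have hf {z : PresentedGroup quotRels} (h : Commute b z) (i) : Commute (f i) z :=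
    zmodPowHom_mul_comm hb hb h.eq i
  have hfg (i) (y) : Commute (f i) (g y) := by
    have hpow (k) : Commute (f i) (zmodPowHom 4 (a * c) hac k) :=
      (zmodPowHom_mul_comm hac hac (hf (hab.symm.mul_right hbc) i).symm.eq k : Commute _ _).symm
    rcases y with k | k
    · exact hpow _
    · exact (hf hab.symm i).mul_right (hpow _)
  have hleft : (f.noncommCoprod g hfg).comp quotToProd = MonoidHom.id _ := by
    refine PresentedGroup.ext fun i => ?_
    rw [MonoidHom.comp_apply, quotToProd_of, MonoidHom.noncommCoprod_apply]
    fin_cases i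
    · change f 1 * g (.sr 0) = a
      rw [map_one, one_mul, dihedralLift_sr_zero]
    · change f (Multiplicative.ofAdd 1) * g 1 = b
      rw [map_one g, mul_one, zmodPowHom_one]
    · change f 1 * g (.sr 1) = c
      rw [map_one, one_mul, dihedralLift_sr_one, ← mul_assoc, ha, one_mul]
  exact Function.LeftInverse.injective (g := f.noncommCoprod g hfg) (DFunLike.congr_fun hleft)

/-- `⟨a, b, c ∣ a², b², c², (ac)⁴, [a,b], [b,c]⟩ ≅ C₂ × D₄`; in particular this
group has order 16. -/
theorem presented_iso_C2_times_D4 :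
    Nonempty (PresentedGroup quotRels ≃* Multiplicative (ZMod 2) × DihedralGroup 4) ∧
      Nat.card (PresentedGroup quotRels) = 16 := by
  let e := MulEquiv.ofBijective quotToProd ⟨quotToProd_injective, quotToProd_surjective⟩
  refine ⟨⟨e⟩, ?_⟩
  rw [Nat.card_congr e.toEquiv, Nat.card_prod, DihedralGroup.nat_card]
  simp
end

section
/- The kernel H of the homomorphism Γ → C₂ sending a to the nontrivial element and b, c to the identity is generated by the four elements β = b, γ = aba, δ = c, ρ = aca, and is isomorphic to the presented group ⟨β, γ, δ, ρ | β², γ², δ², ρ², (ρδ)²⟩ via the map sending β ↦ b, γ ↦ aba, δ ↦ c, ρ ↦ aca. -/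
/-- The relators `a², b², c², (ac)⁴` in the free group on three generators
`a = 0`, `b = 1`, `c = 2`. -/
def gammaRels : Set (FreeGroup (Fin 3)) :=
  {(FreeGroup.of 0) ^ 2, (FreeGroup.of 1) ^ 2, (FreeGroup.of 2) ^ 2,
    (FreeGroup.of 0 * FreeGroup.of 2) ^ 4}

/-- The group `Γ = ⟨a, b, c ∣ a², b², c², (ac)⁴⟩`. -/
abbrev Gam : Type := PresentedGroup gammaRels

/-- The image of the generator `a` in `Γ`. -/
def GamA : Gam := PresentedGroup.of 0
/-- The image of the generator `b` in `Γ`. -/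
def GamB : Gam := PresentedGroup.of 1
/-- The image of the generator `c` in `Γ`. -/
def GamC : Gam := PresentedGroup.of 2


theorem eps_rels : ∀ r ∈ gammaRels,
    FreeGroup.lift (![Multiplicative.ofAdd (1 : ZMod 2), 1, 1] :
      Fin 3 → Multiplicative (ZMod 2)) r = 1 := by
  intro r hr
  rcases hr with rfl | rfl | rfl | rfl <;> simp <;> decide

/-- The homomorphism `Γ → C₂` sending `a` to the nontrivial element and `b`, `c` to the
identity. -/
def epsHom : Gam →* Multiplicative (ZMod 2) := PresentedGroup.toGroup eps_rels

/-- The subgroup `H` of `Γ`: the kernel of `Γ → C₂`, i.e. the stabilizer of the first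
level of the binary tree in `Γ`. -/
def Hsub : Subgroup Gam := MonoidHom.ker epsHom

/-- The relators `β², γ², δ², ρ², (ρδ)²` in the free group on the four generators
`β = 0`, `γ = 1`, `δ = 2`, `ρ = 3`. -/
def HRels : Set (FreeGroup (Fin 4)) :=
  {(FreeGroup.of 0) ^ 2, (FreeGroup.of 1) ^ 2, (FreeGroup.of 2) ^ 2, (FreeGroup.of 3) ^ 2,
    (FreeGroup.of 3 * FreeGroup.of 2) ^ 2}

theorem gamA_mul_self : GamA * GamA = 1 := by
  rw [← pow_two]
  exact PresentedGroup.one_of_mem (rels := gammaRels) (x := FreeGroup.of 0 ^ 2)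
    (by simp [gammaRels])

theorem gamB_mul_self : GamB * GamB = 1 := by
  rw [← pow_two]
  exact PresentedGroup.one_of_mem (rels := gammaRels) (x := FreeGroup.of 1 ^ 2)
    (by simp [gammaRels])

theorem gamC_mul_self : GamC * GamC = 1 := by
  rw [← pow_two]
  exact PresentedGroup.one_of_mem (rels := gammaRels) (x := FreeGroup.of 2 ^ 2)
    (by simp [gammaRels])

theorem gamA_mul_gamC_pow_four : (GamA * GamC) ^ 4 = 1 :=
  PresentedGroup.one_of_mem (rels := gammaRels) (x := (FreeGroup.of 0 * FreeGroup.of 2) ^ 4)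
    (by simp [gammaRels])

theorem HRels_of_mul_self (i : Fin 4) :
    (PresentedGroup.of i * PresentedGroup.of i : PresentedGroup HRels) = 1 := by
  rw [← pow_two]
  exact PresentedGroup.one_of_mem (rels := HRels) (x := FreeGroup.of i ^ 2)
    (by fin_cases i <;> simp [HRels])

theorem HRels_of_three_mul_of_two_sq :
    (PresentedGroup.of 3 * PresentedGroup.of 2 : PresentedGroup HRels) ^ 2 = 1 :=
  PresentedGroup.one_of_mem (rels := HRels) (x := (FreeGroup.of 3 * FreeGroup.of 2) ^ 2)
    (by simp [HRels])

theorem HRels_of_two_mul_of_three_sq :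
    (PresentedGroup.of 2 * PresentedGroup.of 3 : PresentedGroup HRels) ^ 2 = 1 := by
  have h := congrArg (·⁻¹) HRels_of_three_mul_of_two_sq
  have hinv (i : Fin 4) : (PresentedGroup.of i : PresentedGroup HRels)⁻¹ = PresentedGroup.of i :=
    inv_eq_of_mul_eq_one_left (HRels_of_mul_self i)
  simpa only [← inv_pow, mul_inv_rev, hinv, inv_one] using h

/-- The endomorphism of `⟨β, γ, δ, ρ ∣ β², γ², δ², ρ², (ρδ)²⟩` exchanging `β` with `γ` and
`δ` with `ρ`. -/
def swapHom : PresentedGroup HRels →* PresentedGroup HRels :=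
  PresentedGroup.toGroup (f := fun i => PresentedGroup.of ((![1, 0, 3, 2] : Fin 4 → Fin 4) i)) <| by
    rintro r (rfl | rfl | rfl | rfl | rfl)
    · simp [pow_two, HRels_of_mul_self]
    · simp [pow_two, HRels_of_mul_self]
    · simp [pow_two, HRels_of_mul_self]
    · simp [pow_two, HRels_of_mul_self]
    · simpa using HRels_of_two_mul_of_three_sq

theorem swapHom_of (i : Fin 4) :
    swapHom (PresentedGroup.of i) = PresentedGroup.of ((![1, 0, 3, 2] : Fin 4 → Fin 4) i) :=
  PresentedGroup.toGroup.of _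

theorem swapHom_comp_swapHom : swapHom.comp swapHom = MonoidHom.id _ := by
  ext i
  fin_cases i <;> simp [swapHom_of]

/-- `swapHom` as an automorphism. -/
def swapAut : MulAut (PresentedGroup HRels) :=
  MonoidHom.toMulEquiv swapHom swapHom swapHom_comp_swapHom swapHom_comp_swapHom

theorem swapAut_mul_self : swapAut * swapAut = 1 :=
  MulEquiv.ext fun x => DFunLike.congr_fun swapHom_comp_swapHom x

/-- The homomorphism from `C₂` determined by an element of order dividing two. -/
def homOfMulSelf {G : Type*} [Group G] (g : G) (hg : g * g = 1) :
    Multiplicative (ZMod 2) →* G :=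
  MonoidHom.mk' (fun x => if x = 1 then 1 else g) <| by
    intro x y
    obtain rfl | rfl : x = 1 ∨ x = Multiplicative.ofAdd 1 := by revert x; decide
    · simp
    · obtain rfl | rfl : y = 1 ∨ y = Multiplicative.ofAdd 1 := by revert y; decide
      · simp
      · rw [if_pos (by decide), if_neg (by decide), hg]

theorem homOfMulSelf_ofAdd_one {G : Type*} [Group G] (g : G) (hg : g * g = 1) :
    homOfMulSelf g hg (Multiplicative.ofAdd 1) = g := by
  rw [homOfMulSelf, MonoidHom.mk'_apply, if_neg (by decide)]

/-- The action of `C₂` on `⟨β, γ, δ, ρ ∣ β², γ², δ², ρ², (ρδ)²⟩` by `swapAut`. -/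
def swapAction : Multiplicative (ZMod 2) →* MulAut (PresentedGroup HRels) :=
  homOfMulSelf swapAut swapAut_mul_self

theorem swapAction_ofAdd_one_of (i : Fin 4) :
    swapAction (Multiplicative.ofAdd 1) (PresentedGroup.of i) =
      PresentedGroup.of ((![1, 0, 3, 2] : Fin 4 → Fin 4) i) := by
  rw [swapAction, homOfMulSelf_ofAdd_one]
  exact swapHom_of i

/-- The homomorphism `β ↦ b`, `γ ↦ aba`, `δ ↦ c`, `ρ ↦ aca`. -/
def presentationToGam : PresentedGroup HRels →* Gam :=
  PresentedGroup.toGroup (f := ![GamB, GamA * GamB * GamA, GamC, GamA * GamC * GamA]) <| by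
    have conj_mul_self (x : Gam) (hx : x * x = 1) : GamA * x * GamA * (GamA * x * GamA) = 1 := by
      calc _ = GamA * x * (GamA * GamA) * x * GamA := by group
        _ = GamA * (x * x) * GamA := by rw [gamA_mul_self]; group
        _ = 1 := by rw [hx, mul_one, gamA_mul_self]
    rintro r (rfl | rfl | rfl | rfl | rfl)
    · simp [pow_two, gamB_mul_self]
    · simpa [pow_two] using conj_mul_self _ gamB_mul_self
    · simp [pow_two, gamC_mul_self]
    · simpa [pow_two] using conj_mul_self _ gamC_mul_self
    · have h := gamA_mul_gamC_pow_four
      simp only [map_pow, map_mul, FreeGroup.lift_apply_of]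
      change (GamA * GamC * GamA * GamC) ^ 2 = 1
      rwa [mul_assoc (GamA * GamC), ← pow_two, ← pow_mul]

theorem presentationToGam_of (i : Fin 4) :
    presentationToGam (PresentedGroup.of i) =
      (![GamB, GamA * GamB * GamA, GamC, GamA * GamC * GamA] : Fin 4 → Gam) i :=
  PresentedGroup.toGroup.of _

open SemidirectProduct in
theorem inr_mul_inl_of (i : Fin 4) :
    (inr (Multiplicative.ofAdd 1) * inl (PresentedGroup.of i) :
        PresentedGroup HRels ⋊[swapAction] Multiplicative (ZMod 2)) =
      inl (PresentedGroup.of ((![1, 0, 3, 2] : Fin 4 → Fin 4) i)) *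
        inr (Multiplicative.ofAdd 1) := by
  rw [← swapAction_ofAdd_one_of, inl_aut]
  simp [mul_assoc]

open SemidirectProduct in
theorem inr_mul_self :
    (inr (Multiplicative.ofAdd 1) * inr (Multiplicative.ofAdd 1) :
        PresentedGroup HRels ⋊[swapAction] Multiplicative (ZMod 2)) = 1 := by
  rw [← map_mul, show (Multiplicative.ofAdd 1 * Multiplicative.ofAdd 1 :
    Multiplicative (ZMod 2)) = 1 by decide, map_one]

open SemidirectProduct in
theorem inr_mul_inl_of_mul_inr (i : Fin 4) :
    (inr (Multiplicative.ofAdd 1) * inl (PresentedGroup.of i) * inr (Multiplicative.ofAdd 1) :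
        PresentedGroup HRels ⋊[swapAction] Multiplicative (ZMod 2)) =
      inl (PresentedGroup.of ((![1, 0, 3, 2] : Fin 4 → Fin 4) i)) := by
  rw [inr_mul_inl_of, mul_assoc, inr_mul_self, mul_one]

open SemidirectProduct in
/-- The homomorphism from `Γ` to the semidirect product sending `a` to the generator of `C₂`,
`b` to `β` and `c` to `δ`. -/
def gamToSemidirect : Gam →* PresentedGroup HRels ⋊[swapAction] Multiplicative (ZMod 2) :=
  PresentedGroup.toGroup (f := ![inr (Multiplicative.ofAdd 1), inl (PresentedGroup.of 0),
    inl (PresentedGroup.of 2)]) <| by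
    rintro r (rfl | rfl | rfl | rfl)
    · simpa [pow_two] using inr_mul_self
    · simp only [map_pow, FreeGroup.lift_apply_of]
      change inl (PresentedGroup.of 0) ^ 2 = 1
      rw [← map_pow, pow_two, HRels_of_mul_self, map_one]
    · simp only [map_pow, FreeGroup.lift_apply_of]
      change inl (PresentedGroup.of 2) ^ 2 = 1
      rw [← map_pow, pow_two, HRels_of_mul_self, map_one]
    · simp only [map_pow, map_mul, FreeGroup.lift_apply_of]
      change (inr (Multiplicative.ofAdd (1 : ZMod 2)) * inl (PresentedGroup.of 2)) ^ 4 = 1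
      have h : (inr (Multiplicative.ofAdd 1) * inl (PresentedGroup.of 2) :
          PresentedGroup HRels ⋊[swapAction] Multiplicative (ZMod 2)) ^ 2 =
          inl (PresentedGroup.of 3 * PresentedGroup.of 2) := by
        rw [pow_two, ← mul_assoc, inr_mul_inl_of_mul_inr, ← map_mul]
        rfl
      rw [pow_mul _ 2 2, h, ← map_pow, HRels_of_three_mul_of_two_sq, map_one]

open SemidirectProduct in
theorem gamToSemidirect_gamA : gamToSemidirect GamA = inr (Multiplicative.ofAdd 1) :=
  PresentedGroup.toGroup.of _

open SemidirectProduct in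
theorem gamToSemidirect_gamB : gamToSemidirect GamB = inl (PresentedGroup.of 0) :=
  PresentedGroup.toGroup.of _

open SemidirectProduct in
theorem gamToSemidirect_gamC : gamToSemidirect GamC = inl (PresentedGroup.of 2) :=
  PresentedGroup.toGroup.of _

theorem gamToSemidirect_comp_presentationToGam :
    gamToSemidirect.comp presentationToGam = SemidirectProduct.inl := by
  refine PresentedGroup.ext fun i => ?_
  rw [MonoidHom.comp_apply, presentationToGam_of]
  fin_cases i <;>
    simp [gamToSemidirect_gamA, gamToSemidirect_gamB, gamToSemidirect_gamC,
      inr_mul_inl_of_mul_inr]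

theorem presentationToGam_injective : Function.Injective presentationToGam := by
  refine Function.Injective.of_comp (f := gamToSemidirect) ?_
  rw [← MonoidHom.coe_comp, gamToSemidirect_comp_presentationToGam]
  exact SemidirectProduct.inl_injective

/-- The homomorphism from the semidirect product to `Γ`, inverse to `gamToSemidirect`. -/
def semidirectToGam : PresentedGroup HRels ⋊[swapAction] Multiplicative (ZMod 2) →* Gam :=
  SemidirectProduct.lift presentationToGam (homOfMulSelf GamA gamA_mul_self) <| by
    intro x
    obtain rfl | rfl : x = 1 ∨ x = Multiplicative.ofAdd 1 := by revert x; decide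
    · ext; simp
    · have hinv : GamA⁻¹ = GamA := inv_eq_of_mul_eq_one_left gamA_mul_self
      have hcancel (x : Gam) : GamA * (GamA * x) = x := by
        rw [← mul_assoc, gamA_mul_self, one_mul]
      refine PresentedGroup.ext fun i => ?_
      simp only [MonoidHom.comp_apply, MulEquiv.coe_toMonoidHom, swapAction_ofAdd_one_of,
        homOfMulSelf_ofAdd_one, MulAut.conj_apply, presentationToGam_of, hinv]
      fin_cases i <;> simp [mul_assoc, hcancel, gamA_mul_self]

theorem semidirectToGam_comp_gamToSemidirect :
    semidirectToGam.comp gamToSemidirect = MonoidHom.id Gam := by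
  refine PresentedGroup.ext fun i => ?_
  fin_cases i
  · change semidirectToGam (gamToSemidirect GamA) = GamA
    simp [gamToSemidirect_gamA, semidirectToGam, homOfMulSelf_ofAdd_one]
  · change semidirectToGam (gamToSemidirect GamB) = GamB
    simp [gamToSemidirect_gamB, semidirectToGam, presentationToGam_of]
  · change semidirectToGam (gamToSemidirect GamC) = GamC
    simp [gamToSemidirect_gamC, semidirectToGam, presentationToGam_of]

theorem epsHom_gamA : epsHom GamA = Multiplicative.ofAdd 1 := PresentedGroup.toGroup.of _

theorem epsHom_gamB : epsHom GamB = 1 := PresentedGroup.toGroup.of _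

theorem epsHom_gamC : epsHom GamC = 1 := PresentedGroup.toGroup.of _

theorem rightHom_comp_gamToSemidirect :
    SemidirectProduct.rightHom.comp gamToSemidirect = epsHom := by
  refine PresentedGroup.ext fun i => ?_
  fin_cases i
  · change SemidirectProduct.rightHom (gamToSemidirect GamA) = epsHom GamA
    simp [gamToSemidirect_gamA, epsHom_gamA]
  · change SemidirectProduct.rightHom (gamToSemidirect GamB) = epsHom GamB
    simp [gamToSemidirect_gamB, epsHom_gamB]
  · change SemidirectProduct.rightHom (gamToSemidirect GamC) = epsHom GamC
    simp [gamToSemidirect_gamC, epsHom_gamC]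

theorem range_presentationToGam : presentationToGam.range = Hsub := by
  apply le_antisymm
  · rintro _ ⟨x, rfl⟩
    rw [Hsub, MonoidHom.mem_ker, ← rightHom_comp_gamToSemidirect, MonoidHom.comp_apply,
      ← MonoidHom.comp_apply gamToSemidirect, gamToSemidirect_comp_presentationToGam,
      SemidirectProduct.rightHom_inl]
  · intro x hx
    rw [Hsub, MonoidHom.mem_ker, ← rightHom_comp_gamToSemidirect, MonoidHom.comp_apply,
      ← MonoidHom.mem_ker, ← SemidirectProduct.range_inl_eq_ker_rightHom] at hx
    obtain ⟨k, hk⟩ := hx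
    refine ⟨k, ?_⟩
    calc presentationToGam k = semidirectToGam (SemidirectProduct.inl k) := by
          simp [semidirectToGam]
      _ = x := by
          rw [hk]
          exact DFunLike.congr_fun semidirectToGam_comp_gamToSemidirect x

theorem range_presentationToGam_eq_closure :
    presentationToGam.range =
      Subgroup.closure {GamB, GamA * GamB * GamA, GamC, GamA * GamC * GamA} := by
  rw [MonoidHom.range_eq_map, ← PresentedGroup.closure_range_of, MonoidHom.map_closure,
    ← Set.range_comp]
  congr 1
  ext x
  simp [Fin.exists_fin_succ, presentationToGam_of, eq_comm]

/-- `H` is generated by `β = b`, `γ = aba`, `δ = c`, `ρ = aca` and is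
isomorphic to `⟨β, γ, δ, ρ ∣ β², γ², δ², ρ², (ρδ)²⟩` via `β ↦ b`, `γ ↦ aba`, `δ ↦ c`,
`ρ ↦ aca`. -/
theorem Hsub_presentation :
    Subgroup.closure ({GamB, GamA * GamB * GamA, GamC, GamA * GamC * GamA} : Set Gam) = Hsub ∧
    ∃ e : PresentedGroup HRels ≃* Hsub,
      ((e (PresentedGroup.of 0) : Gam) = GamB) ∧
      ((e (PresentedGroup.of 1) : Gam) = GamA * GamB * GamA) ∧
      ((e (PresentedGroup.of 2) : Gam) = GamC) ∧
      ((e (PresentedGroup.of 3) : Gam) = GamA * GamC * GamA) :=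
  ⟨range_presentationToGam_eq_closure.symm.trans range_presentationToGam,
    (MonoidHom.ofInjective presentationToGam_injective).trans
      (MulEquiv.subgroupCongr range_presentationToGam),
    presentationToGam_of 0, presentationToGam_of 1, presentationToGam_of 2,
    presentationToGam_of 3⟩
end

section
/- Let ζ be the unique real root of t³ − 6t² + 11t − 4, and set x = ζ, y = ζ² − 4ζ + 2, z = −1 + 3ζ − ζ². Then x, y, z > 0, x + y + z = 1, the denominator D = z² − 2z + 1 − y² + x²z − x² is nonzero, and the point (x, y, z) is a fixed point of the map F, i.e., F(x, y, z) = (x, y, z). -/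
/-- The denominator `D(x,y,z) = z² − 2z + 1 − y² + x²z − x²`. -/
def Dden (x y z : ℝ) : ℝ := z ^ 2 - 2 * z + 1 - y ^ 2 + x ^ 2 * z - x ^ 2

/-- The rational map `F` sending the coefficient vector of a measure `μ = x·a + y·b + z·c`
to the coefficient vector of the normalized restriction of `μ` at the vertex `0`. -/
noncomputable def Fmap (p : ℝ × ℝ × ℝ) : ℝ × ℝ × ℝ :=
  let x := p.1; let y := p.2.1; let z := p.2.2
  (y * (z ^ 2 - 2 * z + 1 - y ^ 2) / Dden x y z,
   z * (z ^ 2 - 2 * z + 1 - y ^ 2) / Dden x y z,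
   y * x ^ 2 / Dden x y z)

/-- if `ζ` is the (unique) real root of `t³ − 6t² + 11t − 4`, then
`(x, y, z) = (ζ, ζ² − 4ζ + 2, −1 + 3ζ − ζ²)` has positive coordinates summing to `1`,
the denominator `D` does not vanish there, and the point is a fixed point of `F`. -/
theorem fixed_point_of_Fmap :
    ∀ ζ : ℝ, ζ ^ 3 - 6 * ζ ^ 2 + 11 * ζ - 4 = 0 →
      (0 < ζ ∧ 0 < ζ ^ 2 - 4 * ζ + 2 ∧ 0 < -1 + 3 * ζ - ζ ^ 2) ∧
      ζ + (ζ ^ 2 - 4 * ζ + 2) + (-1 + 3 * ζ - ζ ^ 2) = 1 ∧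
      Dden ζ (ζ ^ 2 - 4 * ζ + 2) (-1 + 3 * ζ - ζ ^ 2) ≠ 0 ∧
      Fmap (ζ, ζ ^ 2 - 4 * ζ + 2, -1 + 3 * ζ - ζ ^ 2)
        = (ζ, ζ ^ 2 - 4 * ζ + 2, -1 + 3 * ζ - ζ ^ 2) := by
  intro ζ h
  have lower : 47 / 100 < ζ := by
    by_contra! hle
    nlinarith [sq_nonneg (ζ - 47 / 100), mul_nonneg (sub_nonneg.2 hle) (sq_nonneg (ζ - 3))]
  have upper : ζ < 49 / 100 := by
    by_contra! hle
    nlinarith [mul_nonneg (sub_nonneg.2 hle) (sq_nonneg (ζ - 551 / 200))]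
  have hD : Dden ζ (ζ ^ 2 - 4 * ζ + 2) (-1 + 3 * ζ - ζ ^ 2) ≠ 0 := by
    have hred : Dden ζ (ζ ^ 2 - 4 * ζ + 2) (-1 + 3 * ζ - ζ ^ 2) = -4 + 11 * ζ - 4 * ζ ^ 2 := by
      unfold Dden
      linear_combination (-1 - ζ) * h
    rw [hred]
    have hpos : 0 < -4 + 11 * ζ - 4 * ζ ^ 2 := by nlinarith
    exact hpos.ne'
  refine ⟨⟨by linarith, by nlinarith, by nlinarith⟩, by ring, hD, ?_⟩
  simp only [Fmap, Prod.mk.injEq, div_eq_iff hD]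
  simp only [Dden]
  refine ⟨?_, ?_, ?_⟩
  · linear_combination (-2 * ζ + 3 * ζ ^ 2) * h
  · linear_combination (3 * ζ - 5 * ζ ^ 2 + ζ ^ 3) * h
  · linear_combination (-ζ + 2 * ζ ^ 2 - ζ ^ 3) * h
end

section
/- The point determined by the unique real root ζ of t³ − 6t² + 11t − 4 is the unique fixed point of F in the open simplex: if (x, y, z) ∈ ℝ³ satisfies x, y, z > 0, x + y + z = 1, D(x,y,z) ≠ 0 and F(x, y, z) = (x, y, z), then x = ζ, y = ζ² − 4ζ + 2 and z = −1 + 3ζ − ζ². -/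
/-- Real roots of `t³ − 6t² + 11t − 4` are less than `1`. -/
theorem lt_one_of_cubic_eq_zero {t : ℝ} (h : t ^ 3 - 6 * t ^ 2 + 11 * t - 4 = 0) : t < 1 := by
  by_contra! ht
  nlinarith [mul_nonneg (sub_nonneg.2 ht) (sq_nonneg (t - 5 / 2))]

/-- The polynomial `t³ − 6t² + 11t − 4` has at most one real root. -/
theorem cubic_root_unique {s t : ℝ} (hs : s ^ 3 - 6 * s ^ 2 + 11 * s - 4 = 0)
    (ht : t ^ 3 - 6 * t ^ 2 + 11 * t - 4 = 0) : s = t := by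
  have hs1 := lt_one_of_cubic_eq_zero hs
  have ht1 := lt_one_of_cubic_eq_zero ht
  have hprod : (s - t) * ((s - 2) ^ 2 + (s - 2) * (t - 2) + (t - 2) ^ 2 - 1) = 0 := by
    linear_combination hs - ht
  have hpos : 0 < (s - 2) ^ 2 + (s - 2) * (t - 2) + (t - 2) ^ 2 - 1 := by
    nlinarith [mul_pos (sub_pos.2 hs1) (sub_pos.2 ht1)]
  exact sub_eq_zero.1 ((mul_eq_zero.1 hprod).resolve_right hpos.ne')

/-- uniqueness of the fixed point of `F` in the open simplex: any fixed
point `(x, y, z)` of `F` with `x, y, z > 0`, `x + y + z = 1` and nonvanishing denominator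
is the point determined by the unique real root `ζ` of `t³ − 6t² + 11t − 4`. -/
theorem fixed_point_of_Fmap_unique :
    ∀ ζ x y z : ℝ, ζ ^ 3 - 6 * ζ ^ 2 + 11 * ζ - 4 = 0 →
      0 < x → 0 < y → 0 < z → x + y + z = 1 → Dden x y z ≠ 0 →
      Fmap (x, y, z) = (x, y, z) →
      x = ζ ∧ y = ζ ^ 2 - 4 * ζ + 2 ∧ z = -1 + 3 * ζ - ζ ^ 2 := by
  intro ζ x y z hζ hx hy hz hsum hD hF
  simp only [Fmap, Prod.mk.injEq, div_eq_iff hD] at hF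
  obtain ⟨h1, h2, h3⟩ := hF
  have hz' : z = 1 - x - y := by linear_combination hsum
  have hN : z ^ 2 - 2 * z + 1 - y ^ 2 = x * (x + 2 * y) := by rw [hz']; ring
  rw [hN] at h1 h2
  have hyy : y ^ 2 = x * z := by
    have hne : x * (x + 2 * y) ≠ 0 := by positivity
    exact mul_right_cancel₀ hne (by linear_combination y * h1 - x * h2)
  have hxx : x ^ 2 = z * (x + 2 * y) := by
    have hne : x * y ≠ 0 := by positivity
    exact mul_right_cancel₀ hne (by linear_combination x * h3 - z * h1)
  have hxy : y * (2 - x) = x := by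
    rw [hz'] at hyy hxx
    linear_combination -hxx + 2 * hyy
  have hcubic : x ^ 3 - 6 * x ^ 2 + 11 * x - 4 = 0 := by
    refine mul_left_cancel₀ hx.ne' ?_
    rw [hz'] at hyy
    linear_combination (2 - x) ^ 2 * hyy - (y * (2 - x) + x + x * (2 - x)) * hxy
  have hy' : y = x ^ 2 - 4 * x + 2 := by
    have hne : 2 - x ≠ 0 := by linarith
    exact mul_right_cancel₀ hne (by linear_combination hxy + hcubic)
  obtain rfl := cubic_root_unique hcubic hζ
  exact ⟨rfl, hy', by rw [hz', hy']; ring⟩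
end
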